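/- There is a family, indexed by a set of cardinality 2^{ℵ₀}, of cyclic right ℤG-modules M_α such that: each M_α is residually finite as a ℤG-module (the intersection of all ℤG-submodules of finite index in M_α is zero); the M_α are pairwise non-isomorphic as ℤG-modules; and all M_α have the same finite images, i.e. for every finite ℤG-module F and all indices α, β, F is an image of M_α if and only if F is an image of M_β. -/

import Mathlib

noncomputable section

/-- The 𝔽₂-vector space `V` with basis `{e i, f i : i ∈ ℤ}` (basis indexed by `ℤ × Bool`). -/
abbrev Vsp : Type := (ℤ × Bool) →₀ ZMod 2

/-- The permutation of the basis swapping `e 0` and `f 0`. -/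
def aPerm : Equiv.Perm (ℤ × Bool) := Equiv.swap ((0 : ℤ), false) ((0 : ℤ), true)

/-- The shift permutation of the basis, `e i ↦ e (i+1)`, `f i ↦ f (i+1)`. -/
def tPerm : Equiv.Perm (ℤ × Bool) := (Equiv.addRight (1 : ℤ)).prodCongr (Equiv.refl Bool)

/-- The automorphism of `V` induced by a permutation of the basis, viewed as an automorphism
of the (multiplicatively written) group `V`. -/
def permAut (σ : Equiv.Perm (ℤ × Bool)) : MulAut (Multiplicative Vsp) :=
  AddEquiv.toMultiplicative (Finsupp.domCongr σ : Vsp ≃+ Vsp)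

/-- The automorphism `a` of `V`, swapping `e 0` and `f 0` and fixing the other basis vectors. -/
def aAut : MulAut (Multiplicative Vsp) := permAut aPerm

/-- The automorphism `t` of `V`, with `e i ↦ e (i+1)`, `f i ↦ f (i+1)`. -/
def tAut : MulAut (Multiplicative Vsp) := permAut tPerm

/-- The subgroup `⟨a, t⟩ ≤ GL(V)`. -/
def Asub : Subgroup (MulAut (Multiplicative Vsp)) := Subgroup.closure {aAut, tAut}

/-- The group `G = V ⋊ ⟨a, t⟩ ≅ C₂ ≀ C₂ ≀ C_∞`. -/
abbrev G : Type := Multiplicative Vsp ⋊[Asub.subtype] ↥Asub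

/-- The integral group ring `ℤG`. -/
abbrev ZG : Type := MonoidAlgebra ℤ G

/-- The lamp at position `i` of the `n`-th cyclic configuration is on. -/
def LampOn (n : ℕ) (i : ZMod (8 * (n + 2))) : Prop :=
  i.val < n + 2 ∨ i.val = 2 * (n + 2) ∨ (4 * (n + 2) ≤ i.val ∧ i.val < 5 * (n + 2))

open Classical in
/-- The eigenvalue recording the state of a lamp. -/
def lampSign (n : ℕ) (i : ZMod (8 * (n + 2))) : ℤˣ := if LampOn n i then -1 else 1

/-- The product of the finite modules `𝔽₃[ℤ/8(n+2)]`. -/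
abbrev Wsp : Type := (n : ℕ) → ZMod (8 * (n + 2)) → ZMod 3

/-- The character of `V` by which `V` acts on the basis vector `i` of the `n`-th factor. -/
def weight (n : ℕ) (i : ZMod (8 * (n + 2))) : Vsp →ₗ[ZMod 2] Additive ℤˣ :=
  Finsupp.linearCombination (ZMod 2)
    (fun x : ℤ × Bool => Additive.ofMul (lampSign n (i + (x.1 : ZMod (8 * (n + 2))))))

/-- The exponent of `t` in an element of `⟨a, t⟩`. -/
def shiftExp (α : MulAut (Multiplicative Vsp)) : ℤ :=
  (Multiplicative.toAdd (α (Multiplicative.ofAdd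
    (Finsupp.single ((0 : ℤ), false) (1 : ZMod 2))))).sum fun x c => (c.val : ℤ) * x.1

lemma permAut_single (σ : Equiv.Perm (ℤ × Bool)) (x : ℤ × Bool) :
    permAut σ (Multiplicative.ofAdd (Finsupp.single x (1 : ZMod 2))) =
      Multiplicative.ofAdd (Finsupp.single (σ x) 1) := by
  simp [permAut]

lemma permAut_mul (σ τ : Equiv.Perm (ℤ × Bool)) :
    permAut (σ * τ) = permAut σ * permAut τ := by
  ext v
  rfl

lemma permAut_one : permAut 1 = 1 := by
  ext v
  rfl

lemma permAut_inv (σ : Equiv.Perm (ℤ × Bool)) : permAut σ⁻¹ = (permAut σ)⁻¹ := by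
  rw [eq_inv_iff_mul_eq_one, ← permAut_mul, inv_mul_cancel, permAut_one]

lemma shiftExp_permAut {σ : Equiv.Perm (ℤ × Bool)} {k : ℤ} (h : ∀ x, (σ x).1 = x.1 + k) :
    shiftExp (permAut σ) = k := by
  rw [shiftExp, permAut_single, toAdd_ofAdd, Finsupp.sum_single_index (by simp), h,
    ZMod.val_one, Nat.cast_one, one_mul, zero_add]

lemma exists_perm_of_mem_Asub {α : MulAut (Multiplicative Vsp)} (hα : α ∈ Asub) :
    ∃ (σ : Equiv.Perm (ℤ × Bool)) (k : ℤ), α = permAut σ ∧ ∀ x, (σ x).1 = x.1 + k := by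
  induction hα using Subgroup.closure_induction with
  | mem x hx =>
    rcases hx with rfl | rfl
    · refine ⟨aPerm, 0, rfl, fun x => ?_⟩
      simp only [aPerm, Equiv.swap_apply_def]
      split_ifs <;> simp_all
    · exact ⟨tPerm, 1, rfl, fun x => by simp [tPerm]⟩
  | one => exact ⟨1, 0, permAut_one.symm, fun x => by simp⟩
  | mul x y _ _ hx hy =>
    obtain ⟨σ, k, rfl, hσ⟩ := hx
    obtain ⟨τ, l, rfl, hτ⟩ := hy
    exact ⟨σ * τ, l + k, (permAut_mul σ τ).symm, fun x => by
      rw [Equiv.Perm.mul_apply, hσ, hτ, add_assoc]⟩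
  | inv x _ hx =>
    obtain ⟨σ, k, rfl, hσ⟩ := hx
    refine ⟨σ⁻¹, -k, (permAut_inv σ).symm, fun x => ?_⟩
    have := hσ (σ⁻¹ x)
    rw [← Equiv.Perm.mul_apply, mul_inv_cancel, Equiv.Perm.one_apply] at this
    rw [this]; ring

lemma shiftExp_mul {α β : MulAut (Multiplicative Vsp)} (hα : α ∈ Asub) (hβ : β ∈ Asub) :
    shiftExp (α * β) = shiftExp α + shiftExp β := by
  obtain ⟨σ, k, rfl, hσ⟩ := exists_perm_of_mem_Asub hα
  obtain ⟨τ, l, rfl, hτ⟩ := exists_perm_of_mem_Asub hβ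
  rw [← permAut_mul, shiftExp_permAut hσ, shiftExp_permAut hτ]
  refine shiftExp_permAut fun x => ?_
  rw [Equiv.Perm.mul_apply, hσ, hτ]; ring

lemma weight_apply_of_mem_Asub {α : MulAut (Multiplicative Vsp)} (hα : α ∈ Asub) (n : ℕ)
    (i : ZMod (8 * (n + 2))) (v : Multiplicative Vsp) :
    weight n i (α v).toAdd = weight n (i + (shiftExp α : ZMod (8 * (n + 2)))) v.toAdd := by
  obtain ⟨σ, k, rfl, hσ⟩ := exists_perm_of_mem_Asub hα
  rw [shiftExp_permAut hσ]
  have : (permAut σ v).toAdd = Finsupp.equivMapDomain σ v.toAdd := rfl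
  rw [this, weight, weight, Finsupp.linearCombination_equivMapDomain]
  congr 2
  funext x
  simp [hσ, add_assoc, add_comm]

lemma shiftExp_one : shiftExp 1 = 0 := by simp [shiftExp]

/-- The action of `G` on `Wsp`. -/
def rep : Representation ℤ G Wsp where
  toFun g :=
    { toFun := fun f n i => (weight n i g.left.toAdd).toMul •
        f n (i + (shiftExp g.right : ZMod (8 * (n + 2))))
      map_add' := fun f f' => by ext n i; simp
      map_smul' := fun c f => by
        ext n i
        exact smul_comm _ c _ }
  map_one' := by
    ext f n i
    simp [shiftExp_one]
  map_mul' g h := by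
    ext f n i
    simp only [SemidirectProduct.mul_left, SemidirectProduct.mul_right, toAdd_mul, map_add,
      Subgroup.coe_mul, Module.End.mul_apply, LinearMap.coe_mk, AddHom.coe_mk, toMul_add,
      Subgroup.subtype_apply, weight_apply_of_mem_Asub g.right.2,
      shiftExp_mul g.right.2 h.right.2, Int.cast_add, mul_smul, add_assoc]

/-- The action of `ℤG` on `Wsp`. -/
def act : ZG →ₐ[ℤ] Module.End ℤ Wsp := rep.asAlgebraHom

lemma act_single (g : G) (c : ℤ) (f : Wsp) (n : ℕ) (i : ZMod (8 * (n + 2))) :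
    act (MonoidAlgebra.single g c) f n i = c • ((weight n i g.left.toAdd).toMul •
      f n (i + (shiftExp g.right : ZMod (8 * (n + 2))))) := by
  rw [act, Representation.asAlgebraHom_single]; rfl

/-- The image of `e j` in `G`. -/
def lampG (j : ℤ) : G :=
  SemidirectProduct.inl (Multiplicative.ofAdd (Finsupp.single (j, false) (1 : ZMod 2)))

/-- The image of `t` in `G`. -/
def shiftG : G := SemidirectProduct.inr ⟨tAut, Subgroup.subset_closure (by simp)⟩

lemma act_lampG (j : ℤ) (f : Wsp) (n : ℕ) (i : ZMod (8 * (n + 2))) :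
    act (MonoidAlgebra.single (lampG j) 1) f n i =
      lampSign n (i + (j : ZMod (8 * (n + 2)))) • f n i := by
  rw [act_single]
  simp [lampG, weight, shiftExp_one]

lemma act_shiftG_pow (k : ℕ) (f : Wsp) (n : ℕ) (i : ZMod (8 * (n + 2))) :
    act (MonoidAlgebra.single (shiftG ^ k) 1) f n i = f n (i + (k : ZMod (8 * (n + 2)))) := by
  have ht : shiftExp tAut = 1 := shiftExp_permAut fun x => by simp [tPerm]
  induction k generalizing i with
  | zero => rw [act_single]; simp [shiftExp_one]
  | succ k ih =>
    rw [pow_succ', ← one_mul (1 : ℤ), ← MonoidAlgebra.single_mul_single, map_mul,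
      Module.End.mul_apply, act_single]
    simp only [ih]
    simp only [shiftG, SemidirectProduct.left_inr, SemidirectProduct.right_inr, toAdd_one,
      map_zero, toMul_zero, one_smul, ht]
    congr 1
    push_cast
    ring

lemma shiftG_pow_mul_lampG (k : ℕ) (j : ℤ) :
    shiftG ^ k * lampG j = lampG (j + k) * shiftG ^ k := by
  induction k with
  | zero => simp
  | succ k ih =>
    have h (l : ℤ) : shiftG * lampG l = lampG (l + 1) * shiftG := by
      refine SemidirectProduct.ext ?_ ?_
      · simp only [shiftG, lampG, SemidirectProduct.mul_left, SemidirectProduct.left_inl,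
          SemidirectProduct.left_inr, SemidirectProduct.right_inl, SemidirectProduct.right_inr,
          one_mul, map_one, mul_one, Subgroup.subtype_apply, tAut, permAut_single]
        simp [tPerm]
      · simp [shiftG, lampG]
    rw [pow_succ', mul_assoc, ih, ← mul_assoc, h, mul_assoc]
    simp [add_assoc]

section Definable

/-- A predicate on basis vectors whose coordinate projection is given by an element of `ℤG`. -/
def Definable (S : (n : ℕ) → ZMod (8 * (n + 2)) → Prop) : Prop :=
  ∃ r : ZG, ∀ (f : Wsp) (n : ℕ) (i : ZMod (8 * (n + 2))),
    (S n i → act r f n i = f n i) ∧ (¬ S n i → act r f n i = 0)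

lemma neg_sub_self_zmod_three : ∀ c : ZMod 3, -c - c = c := by decide

lemma definable_lampOn (j : ℤ) :
    Definable fun n i => LampOn n (i + (j : ZMod (8 * (n + 2)))) := by
  refine ⟨MonoidAlgebra.single (lampG j) 1 - 1, fun f n i => ⟨fun h => ?_, fun h => ?_⟩⟩
  · simp only [map_sub, map_one, LinearMap.sub_apply, Pi.sub_apply, act_lampG, lampSign, if_pos h,
      Module.End.one_apply, Units.neg_smul, one_smul]
    exact neg_sub_self_zmod_three _
  · simp [act_lampG, lampSign, h]

lemma Definable.not {S : (n : ℕ) → ZMod (8 * (n + 2)) → Prop} (hS : Definable S) :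
    Definable fun n i => ¬ S n i := by
  obtain ⟨r, hr⟩ := hS
  refine ⟨1 - r, fun f n i => ⟨fun h => ?_, fun h => ?_⟩⟩
  · simp [(hr f n i).2 h]
  · simp [(hr f n i).1 (not_not.1 h)]

lemma Definable.and {S T : (n : ℕ) → ZMod (8 * (n + 2)) → Prop} (hS : Definable S)
    (hT : Definable T) : Definable fun n i => S n i ∧ T n i := by
  obtain ⟨r, hr⟩ := hS
  obtain ⟨s, hs⟩ := hT
  refine ⟨r * s, fun f n i => ?_⟩
  rw [map_mul, Module.End.mul_apply]
  refine ⟨fun h => ?_, fun h => ?_⟩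
  · rw [(hr _ n i).1 h.1, (hs _ n i).1 h.2]
  · by_cases h' : S n i
    · rw [(hr _ n i).1 h', (hs _ n i).2 fun h'' => h ⟨h', h''⟩]
    · rw [(hr _ n i).2 h']

lemma definable_forall_lt (N : ℕ) :
    Definable fun n i => ∀ j < N, LampOn n (i + (j : ZMod (8 * (n + 2)))) := by
  induction N with
  | zero => exact ⟨1, fun f n i => by simp⟩
  | succ N ih =>
    convert ih.and (definable_lampOn N) using 3 with n i
    rw [Nat.forall_lt_succ_right, Int.cast_natCast]

end Definable

section Config

lemma lampOn_natCast {n k : ℕ} (hk : k < 8 * (n + 2)) :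
    LampOn n (k : ZMod (8 * (n + 2))) ↔
      k < n + 2 ∨ k = 2 * (n + 2) ∨ (4 * (n + 2) ≤ k ∧ k < 5 * (n + 2)) := by
  rw [LampOn, ZMod.val_natCast_of_lt hk]

/-- The first or the second position of the long block in the `n`-th configuration. -/
def basePt (b : Bool) (n : ℕ) : ℕ := if b then 4 * (n + 2) else 0

lemma lampOn_basePt_add {b : Bool} {n k : ℕ} (hk : k ≤ n + 2) :
    LampOn n ((basePt b n : ZMod (8 * (n + 2))) + k) ↔ k < n + 2 := by
  rw [← Nat.cast_add, lampOn_natCast] <;> cases b <;> simp [basePt] <;> omega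

lemma not_lampOn_basePt_sub_one (b : Bool) (n : ℕ) :
    ¬ LampOn n ((basePt b n : ZMod (8 * (n + 2))) + (-1 : ℤ)) := by
  have h : (basePt b n : ZMod (8 * (n + 2))) + (-1 : ℤ) =
      ((if b then 4 * (n + 2) - 1 else 8 * (n + 2) - 1 : ℕ) : ZMod (8 * (n + 2))) := by
    cases b
    · have := ZMod.natCast_self (8 * (n + 2))
      simp only [basePt, Bool.false_eq_true, if_false, Nat.cast_zero]
      rw [Nat.cast_sub (by omega), this]
      simp
    · simp only [basePt, if_true]
      rw [Nat.cast_sub (by omega)]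
      push_cast
      ring
  rw [h, lampOn_natCast] <;> cases b <;> simp <;> omega

lemma lampOn_basePt_add_marker (b : Bool) (n : ℕ) :
    LampOn n ((basePt b n : ZMod (8 * (n + 2))) + (2 * (n + 2) : ℕ)) ↔ b = false := by
  rw [← Nat.cast_add, lampOn_natCast] <;> cases b <;> simp [basePt] <;> omega

lemma forall_lampOn_basePt_iff {b : Bool} {n N : ℕ} :
    (∀ j < N + 2, LampOn n ((basePt b n : ZMod (8 * (n + 2))) + (j : ZMod (8 * (n + 2))))) ↔
      N ≤ n := by
  constructor
  · intro h
    by_contra! hlt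
    exact absurd ((lampOn_basePt_add le_rfl).1 (h (n + 2) (by omega))) (lt_irrefl _)
  · intro h j hj
    exact (lampOn_basePt_add (by omega)).2 (by omega)

/-- The predicate that a maximal block of lamps of length `N + 2` starts at `i`. -/
def IsBlock (N n : ℕ) (i : ZMod (8 * (n + 2))) : Prop :=
  (¬ LampOn n (i + ((-1 : ℤ) : ZMod (8 * (n + 2))))) ∧
    (¬ LampOn n (i + (((N + 2 : ℕ) : ℤ) : ZMod (8 * (n + 2))))) ∧
    ∀ j < N + 2, LampOn n (i + (j : ZMod (8 * (n + 2))))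

lemma definable_isBlock (N : ℕ) : Definable (IsBlock N) :=
  (definable_lampOn _).not.and ((definable_lampOn _).not.and (definable_forall_lt _))

lemma isBlock_basePt (b : Bool) (n : ℕ) : IsBlock n n (basePt b n : ZMod (8 * (n + 2))) := by
  refine ⟨not_lampOn_basePt_sub_one b n, ?_, forall_lampOn_basePt_iff.2 le_rfl⟩
  rw [Int.cast_natCast, lampOn_basePt_add le_rfl]
  exact lt_irrefl _

lemma IsBlock.eq {N n : ℕ} {i : ZMod (8 * (n + 2))} (h : IsBlock N n i) :
    N = n ∧ ∃ b, i = (basePt b n : ZMod (8 * (n + 2))) := by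
  obtain ⟨k, hk, rfl⟩ : ∃ k : ℕ, k < 8 * (n + 2) ∧ (k : ZMod (8 * (n + 2))) = i :=
    ⟨i.val, ZMod.val_lt i, ZMod.natCast_zmod_val i⟩
  obtain ⟨h₁, h₂, h₃⟩ := h
  have h₃' (j : ℕ) (hj : j < N + 2) (hlt : k + j < 8 * (n + 2)) :
      k + j < n + 2 ∨ k + j = 2 * (n + 2) ∨ (4 * (n + 2) ≤ k + j ∧ k + j < 5 * (n + 2)) := by
    have := h₃ j hj
    rwa [← Nat.cast_add, lampOn_natCast hlt] at this
  have h₂' (hlt : k + (N + 2) < 8 * (n + 2)) : ¬ (k + (N + 2) < n + 2 ∨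
      k + (N + 2) = 2 * (n + 2) ∨ (4 * (n + 2) ≤ k + (N + 2) ∧ k + (N + 2) < 5 * (n + 2))) := by
    rwa [Int.cast_natCast, ← Nat.cast_add, lampOn_natCast hlt] at h₂
  have h₁' (hpos : 0 < k) : ¬ (k - 1 < n + 2 ∨ k - 1 = 2 * (n + 2) ∨
      (4 * (n + 2) ≤ k - 1 ∧ k - 1 < 5 * (n + 2))) := by
    have : (k : ZMod (8 * (n + 2))) + (-1 : ℤ) = ((k - 1 : ℕ) : ZMod (8 * (n + 2))) := by
      rw [Nat.cast_sub (by omega)]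
      push_cast
      ring
    rwa [this, lampOn_natCast (by omega)] at h₁
  have hk' : k = 0 ∨ k = 4 * (n + 2) := by
    have := h₃' 0 (by omega) (by omega)
    have := h₃' 1 (by omega)
    omega
  have hN : N = n := by
    rcases lt_trichotomy N n with h | h | h
    · omega
    · exact h
    · have := h₃' (n + 2) (by omega) (by omega)
      omega
  refine ⟨hN, k ≠ 0, ?_⟩
  rcases hk' with rfl | rfl <;> simp [basePt]

end Config

/-- The element of `Wsp` selecting one base point in each factor. -/
def gen (φ : ℕ → Bool) : Wsp := fun n => Pi.single (basePt (φ n) n : ZMod (8 * (n + 2))) 1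

/-- The annihilator of `gen φ`. -/
def annGen (φ : ℕ → Bool) : Ideal ZG where
  carrier := {r | act r (gen φ) = 0}
  zero_mem' := by simp
  add_mem' := fun ha hb => by simp_all
  smul_mem' := fun c r hr => by simp_all

lemma mem_annGen {φ : ℕ → Bool} {r : ZG} : r ∈ annGen φ ↔ act r (gen φ) = 0 := Iff.rfl

/-- Restriction to the first `N` factors. -/
def trunc (N : ℕ) (f : Wsp) : Wsp := fun n => if n < N then f n else 0

lemma gen_apply_eq_zero {φ : ℕ → Bool} {n : ℕ} {i : ZMod (8 * (n + 2))}
    (h : i ≠ (basePt (φ n) n : ZMod (8 * (n + 2)))) : gen φ n i = 0 := by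
  rw [gen, Pi.single_eq_of_ne h]

lemma act_apply_congr (r : ZG) {f f' : Wsp} {n : ℕ} (h : f n = f' n) :
    act r f n = act r f' n := by
  induction r using MonoidAlgebra.induction_linear with
  | zero => simp
  | add r s hr hs => simp [hr, hs]
  | single g c =>
    ext i
    rw [act_single, act_single, h]

lemma act_trunc (r : ZG) (N : ℕ) (f : Wsp) : act r (trunc N f) = trunc N (act r f) := by
  ext1 n
  by_cases h : n < N
  · rw [act_apply_congr r (f' := f) (by simp [trunc, h])]
    simp [trunc, h]
  · rw [act_apply_congr r (f' := 0) (by simp [trunc, h])]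
    simp [trunc, h]

lemma exists_act_gen_eq_sub_trunc (N : ℕ) :
    ∃ r : ZG, ∀ φ, act r (gen φ) = gen φ - trunc N (gen φ) := by
  obtain ⟨r, hr⟩ := definable_forall_lt (N + 2)
  refine ⟨r, fun φ => ?_⟩
  ext n i
  by_cases hi : i = (basePt (φ n) n : ZMod (8 * (n + 2)))
  · subst hi
    have := hr (gen φ) n (basePt (φ n) n)
    simp only [forall_lampOn_basePt_iff] at this
    by_cases h : N ≤ n
    · rw [this.1 h]; simp [trunc, not_lt.2 h]
    · rw [this.2 h]; simp [trunc, not_le.1 h]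
  · have h0 : gen φ n i = 0 := gen_apply_eq_zero hi
    have hL : act r (gen φ) n i = 0 := by
      by_cases h : ∀ j < N + 2, LampOn n (i + (j : ZMod (8 * (n + 2))))
      · rw [(hr _ n i).1 h, h0]
      · rw [(hr _ n i).2 h]
    rw [hL]
    simp only [Pi.sub_apply, h0, trunc]
    split_ifs <;> simp [h0]

lemma exists_act_gen_eq_trunc (φ ψ : ℕ → Bool) (N : ℕ) :
    ∃ r : ZG, act r (gen φ) = trunc N (gen ψ) := by
  induction N with
  | zero => exact ⟨0, by ext n i; simp [trunc]⟩
  | succ N ih =>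
    obtain ⟨r, hr⟩ := ih
    obtain ⟨s, hs⟩ := exists_act_gen_eq_sub_trunc N
    obtain ⟨s', hs'⟩ := exists_act_gen_eq_sub_trunc (N + 1)
    let k : ℕ := if φ N = ψ N then 0 else 4 * (N + 2)
    refine ⟨r + MonoidAlgebra.single (shiftG ^ k) 1 * (s - s'), ?_⟩
    ext n i
    simp only [map_add, map_mul, map_sub, LinearMap.add_apply, Module.End.mul_apply,
      LinearMap.sub_apply, hr, hs, hs', Pi.add_apply, act_shiftG_pow, Pi.sub_apply, trunc]
    rcases lt_trichotomy n N with h | rfl | h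
    · simp [h, h.trans (Nat.lt_succ_self N)]
    · have hp : (8 * (n + 2) : ZMod (8 * (n + 2))) = 0 := by
        exact_mod_cast ZMod.natCast_self (8 * (n + 2))
      have key : i + (k : ZMod (8 * (n + 2))) = (basePt (φ n) n : ZMod (8 * (n + 2))) ↔
          i = (basePt (ψ n) n : ZMod (8 * (n + 2))) := by
        have h4 : (4 * (n + 2) : ZMod (8 * (n + 2))) = -(4 * (n + 2)) := by
          rw [eq_neg_iff_add_eq_zero, ← hp]; ring
        cases h1 : φ n <;> cases h2 : ψ n <;> simp [k, basePt, h1, h2]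
        · rw [add_eq_zero_iff_eq_neg, ← h4]
      simp [gen, Pi.single_apply, key]
    · simp [not_lt.2 h.le, not_lt.2 (Nat.succ_le_of_lt h)]

section FiniteImages

lemma exists_shiftG_pow_smul_eq (F : Type*) [AddCommGroup F] [Module ZG F] [Finite F] :
    ∃ q : ℕ, 0 < q ∧ ∀ w : F, (MonoidAlgebra.single (shiftG ^ q) (1 : ℤ) : ZG) • w = w := by
  have : Finite (AddMonoid.End F) :=
    Finite.of_injective (fun f => (f : F → F)) DFunLike.coe_injective
  let H : G →* (AddMonoid.End F)ˣ :=
    ((Module.toAddMonoidEnd ZG F).toMonoidHom.comp (MonoidAlgebra.of ℤ G)).toHomUnits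
  refine ⟨Nat.card (AddMonoid.End F)ˣ, Nat.card_pos, fun w => ?_⟩
  have h : H (shiftG ^ Nat.card (AddMonoid.End F)ˣ) = 1 := by rw [map_pow, pow_card_eq_one']
  exact DFunLike.congr_fun (congrArg Units.val h) w

lemma lampG_smul_eq {F : Type*} [AddCommGroup F] [Module ZG F] {q : ℕ}
    (hq : ∀ w : F, (MonoidAlgebra.single (shiftG ^ q) (1 : ℤ) : ZG) • w = w) (j : ℤ) (w : F) :
    (MonoidAlgebra.single (lampG (j + q)) (1 : ℤ) : ZG) • w =
      (MonoidAlgebra.single (lampG j) (1 : ℤ) : ZG) • w := by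
  have h := congrArg (fun g : G => (MonoidAlgebra.single g (1 : ℤ) : ZG) • w)
    (shiftG_pow_mul_lampG q j)
  have hmul (g g' : G) : (MonoidAlgebra.single (g * g') (1 : ℤ) : ZG) =
      MonoidAlgebra.single g 1 * MonoidAlgebra.single g' 1 := by
    rw [MonoidAlgebra.single_mul_single, one_mul]
  simp only [hmul, mul_smul, hq] at h
  exact h.symm

lemma lampG_add_mul_mem_annGen (φ : ℕ → Bool) {q : ℕ} (hq : 0 < q) {r : ZG}
    (hr : act r (gen φ) = gen φ - trunc q (gen φ)) :
    (MonoidAlgebra.single (lampG (-1 + q)) 1 + MonoidAlgebra.single (lampG (-1)) 1) * r ∈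
      annGen φ := by
  rw [mem_annGen, map_mul, Module.End.mul_apply, hr]
  ext n i
  rw [map_add, LinearMap.add_apply, Pi.add_apply, Pi.add_apply, act_lampG, act_lampG]
  by_cases hi : i = (basePt (φ n) n : ZMod (8 * (n + 2)))
  · by_cases hn : n < q
    · simp [trunc, hn]
    · have h₁ : LampOn n (i + ((-1 + q : ℤ) : ZMod (8 * (n + 2)))) := by
        have : ((-1 + q : ℤ) : ZMod (8 * (n + 2))) = ((q - 1 : ℕ) : ZMod (8 * (n + 2))) := by
          rw [Nat.cast_sub hq]
          push_cast
          ring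
        rw [hi, this, lampOn_basePt_add (by omega)]
        omega
      have h₂ : ¬ LampOn n (i + ((-1 : ℤ) : ZMod (8 * (n + 2)))) := by
        rw [hi]
        exact not_lampOn_basePt_sub_one _ _
      rw [lampSign, lampSign, if_pos h₁, if_neg h₂]
      simp
  · have h0 : (gen φ - trunc q (gen φ)) n i = 0 := by
      have := gen_apply_eq_zero hi
      simp only [Pi.sub_apply, trunc]
      split_ifs <;> simp [this]
    simp [h0]

lemma three_mem_annGen (φ : ℕ → Bool) : (3 : ZG) ∈ annGen φ := by
  rw [mem_annGen, map_ofNat]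
  ext n i
  have : (3 : ZMod 3) = 0 := rfl
  have h3 : ((3 : Module.End ℤ Wsp) (gen φ)) n i = 3 * gen φ n i := by
    rw [Module.End.ofNat_apply]; simp
  rw [h3, this, zero_mul]; rfl

/-- An element annihilated by `annGen φ` in a finite module generates the same submodule as some
element annihilated by `annGen ψ`. -/
lemma exists_generator_of_annGen {F : Type*} [AddCommGroup F] [Module ZG F] [Finite F]
    (φ ψ : ℕ → Bool) (w : F) (hw : ∀ r ∈ annGen φ, r • w = 0) :
    ∃ w' : F, (∀ r ∈ annGen ψ, r • w' = 0) ∧ ∃ r : ZG, r • w' = w := by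
  obtain ⟨q, hq, hqF⟩ := exists_shiftG_pow_smul_eq F
  obtain ⟨e, he⟩ := exists_act_gen_eq_sub_trunc q
  obtain ⟨r, hr⟩ := exists_act_gen_eq_trunc φ ψ q
  obtain ⟨r', hr'⟩ := exists_act_gen_eq_trunc ψ φ q
  have htr (χ : ℕ → Bool) : trunc q (trunc q (gen χ)) = trunc q (gen χ) := by
    ext n i
    by_cases h : n < q <;> simp [trunc, h]
  have hew : e • w = 0 := by
    have h := hw _ (lampG_add_mul_mem_annGen φ hq (he φ))
    rw [mul_smul, add_smul, lampG_smul_eq hqF] at h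
    have h3 := hw _ (Ideal.mul_mem_left _ (MonoidAlgebra.single (lampG (-1)) 1 * e)
      (three_mem_annGen φ))
    rw [show (MonoidAlgebra.single (lampG (-1)) 1 * e * 3 : ZG) =
      MonoidAlgebra.single (lampG (-1)) 1 * e + (MonoidAlgebra.single (lampG (-1)) 1 * e +
      MonoidAlgebra.single (lampG (-1)) 1 * e) by noncomm_ring, add_smul, add_smul, mul_smul,
      h, add_zero] at h3
    have hu : (MonoidAlgebra.single (lampG (-1))⁻¹ 1 * MonoidAlgebra.single (lampG (-1)) 1 : ZG)
        = 1 := by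
      rw [MonoidAlgebra.single_mul_single, inv_mul_cancel, one_mul, MonoidAlgebra.one_def]
    rw [← one_smul ZG (e • w), ← hu, mul_smul, h3, smul_zero]
  refine ⟨r • w, fun s hs => ?_, r', ?_⟩
  · rw [← mul_smul]
    refine hw _ ?_
    rw [mem_annGen, map_mul, Module.End.mul_apply, hr, act_trunc, mem_annGen.1 hs]
    ext n i
    simp [trunc]
  · have hmem : r' * r - 1 + e ∈ annGen φ := by
      rw [mem_annGen, map_add, map_sub, map_mul, map_one, LinearMap.add_apply,
        LinearMap.sub_apply, Module.End.mul_apply, hr, act_trunc, hr', htr, he]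
      simp
    have := hw _ hmem
    rwa [add_smul, sub_smul, hew, add_zero, sub_eq_zero, one_smul, mul_smul] at this

lemma exists_surjective_of_annGen {F : Type*} [AddCommGroup F] [Module ZG F] [Finite F]
    (φ ψ : ℕ → Bool) (h : ∃ f : (ZG ⧸ annGen φ) →ₗ[ZG] F, Function.Surjective f) :
    ∃ f : (ZG ⧸ annGen ψ) →ₗ[ZG] F, Function.Surjective f := by
  obtain ⟨f, hf⟩ := h
  obtain ⟨w', hw', r, hr⟩ := exists_generator_of_annGen φ ψ (f (Submodule.Quotient.mk 1))
    fun s hs => by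
      rw [← map_smul, ← Submodule.Quotient.mk_smul, smul_eq_mul, mul_one,
        (Submodule.Quotient.mk_eq_zero _).2 hs, map_zero]
  refine ⟨(annGen ψ).liftQ (LinearMap.toSpanSingleton ZG F w') fun s hs => by simpa using hw' s hs,
    fun y => ?_⟩
  obtain ⟨x, rfl⟩ := hf y
  obtain ⟨x, rfl⟩ := Submodule.Quotient.mk_surjective _ x
  refine ⟨Submodule.Quotient.mk (x * r), ?_⟩
  rw [Submodule.liftQ_apply, LinearMap.toSpanSingleton_apply, mul_smul, hr, ← map_smul,
    ← Submodule.Quotient.mk_smul, smul_eq_mul, mul_one]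

end FiniteImages

section ResiduallyFinite

/-- The finite-index submodule of classes annihilating the `n`-th coordinate of `gen φ`. -/
def coordKer (φ : ℕ → Bool) (n : ℕ) : Ideal ZG where
  carrier := {r | act r (gen φ) n = 0}
  zero_mem' := by simp
  add_mem' := fun ha hb => by simp_all
  smul_mem' := fun c r hr => by
    change act (c * r) (gen φ) n = 0
    rw [map_mul, Module.End.mul_apply, act_apply_congr c (f' := 0) hr]
    simp

lemma exists_finite_quotient (φ : ℕ → Bool) (m : ZG ⧸ annGen φ) (hm : m ≠ 0) :
    ∃ N : Submodule ZG (ZG ⧸ annGen φ), Finite ((ZG ⧸ annGen φ) ⧸ N) ∧ m ∉ N := by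
  obtain ⟨r, rfl⟩ := Submodule.Quotient.mk_surjective _ m
  rw [Ne, Submodule.Quotient.mk_eq_zero, mem_annGen, funext_iff, not_forall] at hm
  obtain ⟨n, hn⟩ := hm
  have hle : annGen φ ≤ coordKer φ n := fun s hs => congrFun (mem_annGen.1 hs) n
  refine ⟨Submodule.map (annGen φ).mkQ (coordKer φ n), ?_, ?_⟩
  · have : Finite (ZG ⧸ coordKer φ n) := by
      let g : ZG →+ (ZMod (8 * (n + 2)) → ZMod 3) :=
        { toFun := fun r => act r (gen φ) n
          map_zero' := by simp
          map_add' := fun r s => by simp }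
      have hg (x y : ZG) : g x = g y ↔ x - y ∈ coordKer φ n := by
        rw [← sub_eq_zero, ← map_sub]; rfl
      refine Finite.of_injective (Quotient.lift g fun x y hxy => (hg x y).2 ?_) ?_
      · exact (Submodule.quotientRel_def _).1 hxy
      · rintro ⟨x⟩ ⟨y⟩ hxy
        exact (Submodule.Quotient.eq _).2 ((hg x y).1 hxy)
    exact Finite.of_equiv _ (Submodule.quotientQuotientEquivQuotient _ _ hle).symm.toEquiv
  · intro hmem
    have hr : r ∈ Submodule.comap (annGen φ).mkQ (Submodule.map (annGen φ).mkQ (coordKer φ n)) :=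
      hmem
    rw [Submodule.comap_map_mkQ, sup_eq_right.2 hle] at hr
    exact hn hr

end ResiduallyFinite

section NonIso

lemma exists_bound_act_gen (φ : ℕ → Bool) (r : ZG) :
    ∃ D : ℕ, ∀ (n : ℕ) (i : ZMod (8 * (n + 2))), act r (gen φ) n i ≠ 0 →
      ∃ d : ℤ, |d| ≤ D ∧ i = (basePt (φ n) n : ZMod (8 * (n + 2))) + d := by
  induction r using MonoidAlgebra.induction_linear with
  | zero => exact ⟨0, fun n i h => absurd (by simp) h⟩
  | add r s hr hs =>
    obtain ⟨D, hD⟩ := hr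
    obtain ⟨E, hE⟩ := hs
    refine ⟨max D E, fun n i h => ?_⟩
    by_cases h' : act r (gen φ) n i = 0
    · obtain ⟨d, hd, hi⟩ := hE n i fun h'' => h (by simp [h', h''])
      exact ⟨d, hd.trans (by simp), hi⟩
    · obtain ⟨d, hd, hi⟩ := hD n i h'
      exact ⟨d, hd.trans (by simp), hi⟩
  | single g c =>
    refine ⟨(shiftExp g.right).natAbs, fun n i h => ⟨-shiftExp g.right, by simp, ?_⟩⟩
    rw [act_single] at h
    by_contra hi
    refine h ?_
    rw [gen_apply_eq_zero, smul_zero, smul_zero]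
    contrapose! hi
    rw [← hi]
    push_cast
    ring

lemma exists_mem_annGen_not_mem {φ ψ : ℕ → Bool} (h : ∀ D : ℕ, ∃ n ≥ D, φ n ≠ ψ n) (r : ZG) :
    ∃ s : ZG, s * r ∈ annGen ψ ∧ s ∉ annGen φ := by
  obtain ⟨D, hD⟩ := exists_bound_act_gen ψ r
  obtain ⟨n, hn, hne⟩ := h D
  have hM : Definable fun m i => φ n = false ↔
      LampOn m (i + (((2 * (n + 2) : ℕ) : ℤ) : ZMod (8 * (m + 2)))) := by
    cases φ n
    · simpa only [true_iff] using definable_lampOn _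
    · simpa only [Bool.true_eq_false, false_iff] using (definable_lampOn _).not
  obtain ⟨s, hs⟩ := (definable_isBlock n).and hM
  refine ⟨s, ?_, fun hmem => ?_⟩
  · rw [mem_annGen, map_mul, Module.End.mul_apply]
    ext m i
    by_cases hi : IsBlock n m i ∧ (φ n = false ↔
      LampOn m (i + (((2 * (n + 2) : ℕ) : ℤ) : ZMod (8 * (m + 2)))))
    · rw [(hs _ m i).1 hi]
      obtain ⟨hb, hl⟩ := hi
      obtain ⟨rfl, b, rfl⟩ := hb.eq
      rw [Int.cast_natCast, lampOn_basePt_add_marker] at hl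
      by_contra hne0
      obtain ⟨d, hd, hbd⟩ := hD n _ hne0
      have hb' : b = !ψ n := by
        revert hl hne
        cases b <;> cases φ n <;> cases ψ n <;> simp
      have hdvd : ((8 * (n + 2) : ℕ) : ℤ) ∣ (basePt b n : ℤ) - (basePt (ψ n) n + d) := by
        rw [← ZMod.intCast_zmod_eq_zero_iff_dvd]
        push_cast
        rw [hbd]
        ring
      obtain ⟨c, hc⟩ := hdvd
      have hd' := abs_le.1 (hd.trans (Nat.cast_le.2 hn))
      have hc0 : c ≤ 0 ∨ 1 ≤ c := by omega
      have hc1 : c ≤ -1 ∨ 0 ≤ c := by omega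
      subst hb'
      cases h : ψ n <;> simp [h, basePt] at hc
      · rcases hc0 with h0 | h0 <;> nlinarith
      · rcases hc1 with h1 | h1 <;> nlinarith
    · rw [(hs _ m i).2 hi]; rfl
  · have := (hs (gen φ) n (basePt (φ n) n)).1 ⟨isBlock_basePt _ _, by
      rw [Int.cast_natCast, lampOn_basePt_add_marker]⟩
    rw [mem_annGen.1 hmem] at this
    simp [gen] at this

lemma not_nonempty_linearEquiv {φ ψ : ℕ → Bool} (h : ∀ D : ℕ, ∃ n ≥ D, φ n ≠ ψ n) :
    ¬ Nonempty ((ZG ⧸ annGen φ) ≃ₗ[ZG] (ZG ⧸ annGen ψ)) := by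
  rintro ⟨f⟩
  obtain ⟨r, hr⟩ := Submodule.Quotient.mk_surjective _ (f (Submodule.Quotient.mk 1))
  obtain ⟨s, hs, hs'⟩ := exists_mem_annGen_not_mem h r
  refine hs' ?_
  rw [← Submodule.Quotient.mk_eq_zero, ← mul_one s, ← smul_eq_mul, Submodule.Quotient.mk_smul,
    ← f.map_eq_zero_iff, map_smul, ← hr, ← Submodule.Quotient.mk_smul,
    Submodule.Quotient.mk_eq_zero]
  exact hs

end NonIso

/-- **Proposition 1.**  There is a family, indexed by a set of cardinality `2^ℵ₀`, of cyclic
`ℤG`-modules (realised as quotients `ℤG/J x` of `ℤG` by ideals, mirroring the paper's right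
modules by left modules) which are residually finite, pairwise non-isomorphic, and all have
the same finite images. -/
theorem prop_mod :
    ∃ (X : Type) (J : X → Ideal ZG),
      Cardinal.mk X = 2 ^ Cardinal.aleph0 ∧
      (∀ x : X, ∀ m : ZG ⧸ J x, m ≠ 0 →
        ∃ N : Submodule ZG (ZG ⧸ J x), Finite ((ZG ⧸ J x) ⧸ N) ∧ m ∉ N) ∧
      (∀ x y : X, Nonempty ((ZG ⧸ J x) ≃ₗ[ZG] (ZG ⧸ J y)) → x = y) ∧
      (∀ (F : Type) [AddCommGroup F] [Module ZG F] [Finite F], ∀ x y : X,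
        (∃ φ : (ZG ⧸ J x) →ₗ[ZG] F, Function.Surjective φ) ↔
        (∃ φ : (ZG ⧸ J y) →ₗ[ZG] F, Function.Surjective φ)) := by
  refine ⟨ℕ → Bool, fun x => annGen fun n => x n.unpair.1, by simp,
    fun x => exists_finite_quotient _, fun x y h => ?_,
    fun F _ _ _ x y => ⟨exists_surjective_of_annGen _ _, exists_surjective_of_annGen _ _⟩⟩
  by_contra hne
  obtain ⟨k, hk⟩ := Function.ne_iff.1 hne
  refine not_nonempty_linearEquiv (fun D => ⟨Nat.pair k D, Nat.right_le_pair k D, ?_⟩) h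
  simpa using hk
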